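/- arXiv:2503.23100 — 2 statements merged into one kernel-verified Lean document; each statement's English description precedes it below -/
import Mathlib

section
/- Let n, m, N, s be positive integers, W ∈ ℝ^{(mN)×n}, X ∈ ℝ^{n×s} with X Xᵀ positive definite, and L ∈ ℝ^{n×n} invertible with X Xᵀ = L Lᵀ (a Cholesky factor). Let W̃ := W L ∈ ℝ^{(mN)×n}, and let W̃ = Ũ Σ̃ Ṽᵀ be a singular value decomposition with singular values σ̃_1 ≥ … ≥ σ̃_{min(n,mN)}. Define A* = Ũ_m Σ̃_m^{1/2} ∈ ℝ^{(mN)×m} and B* = Σ̃_m^{1/2} Ṽ_mᵀ L^{-1} ∈ ℝ^{m×n}, where Ũ_m, Ṽ_m are the first m columns of Ũ, Ṽ and Σ̃_m^{1/2} = diag(√σ̃_1,…,√σ̃_m). Then for all A ∈ ℝ^{(mN)×m} and B ∈ ℝ^{m×n}, ‖W X − A* B* X‖_F ≤ ‖W X − A B X‖_F; that is, (A*, B*) is a global minimizer of (1/2)‖W X − A B X‖_F². -/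
open Matrix

/-- Squared Frobenius norm of a real matrix. -/
noncomputable def frobSq {α β : Type*} [Fintype α] [Fintype β] (M : Matrix α β ℝ) : ℝ :=
  ∑ i, ∑ j, (M i j) ^ 2

/-- Frobenius norm of a real matrix. -/
noncomputable def frobNorm {α β : Type*} [Fintype α] [Fintype β] (M : Matrix α β ℝ) : ℝ :=
  Real.sqrt (frobSq M)

lemma molae_frobSq_trace {α β : Type*} [Fintype α] [Fintype β] (M : Matrix α β ℝ) :
    frobSq M = (M * Mᵀ).trace := by
  simp [frobSq, Matrix.trace, Matrix.mul_apply, pow_two]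

lemma molae_frobSq_nonneg {α β : Type*} [Fintype α] [Fintype β] (M : Matrix α β ℝ) :
    0 ≤ frobSq M :=
  Finset.sum_nonneg fun _ _ => Finset.sum_nonneg fun _ _ => sq_nonneg _

/-- Orthogonal projection onto the column space. -/
lemma molae_exists_proj {p m : ℕ} (C : Matrix (Fin p) (Fin m) ℝ) :
    ∃ Q : Matrix (Fin p) (Fin p) ℝ, Qᵀ = Q ∧ Q * Q = Q ∧ Q * C = C ∧ Q.trace ≤ m := by
  let K := LinearMap.range (Matrix.toEuclideanLin C)
  let Q : Matrix (Fin p) (Fin p) ℝ :=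
    (Matrix.toEuclideanCLM (n := Fin p) (𝕜 := ℝ)).symm K.starProjection
  have hQ : Matrix.toEuclideanCLM (n := Fin p) (𝕜 := ℝ) Q = K.starProjection := by simp [Q]
  refine ⟨Q, ?_, ?_, ?_, ?_⟩
  · have : star Q = Q := by
      apply (Matrix.toEuclideanCLM (n := Fin p) (𝕜 := ℝ)).injective
      have h0 : Matrix.toEuclideanCLM (n := Fin p) (𝕜 := ℝ) (star Q) =
          star (Matrix.toEuclideanCLM (n := Fin p) (𝕜 := ℝ) Q) :=
        (Matrix.toEuclideanCLM (n := Fin p) (𝕜 := ℝ)).map_star' Q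
      rw [hQ, (isSelfAdjoint_starProjection K).star_eq] at h0
      exact h0.trans hQ.symm
    simpa [Matrix.star_eq_conjTranspose] using this
  · rw [← map_mul, K.isIdempotentElem_starProjection.eq]
  · have h : ∀ v : Fin m → ℝ, (Q * C) *ᵥ v = C *ᵥ v := by
      intro v
      have h1 : K.starProjection (Matrix.toEuclideanLin C (WithLp.toLp 2 v)) =
          Matrix.toEuclideanLin C (WithLp.toLp 2 v) :=
        Submodule.starProjection_eq_self_iff.mpr (LinearMap.mem_range_self _ _)
      rw [← hQ] at h1
      have h2 := congrArg WithLp.ofLp h1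
      rw [← Matrix.mulVec_mulVec]
      exact h2
    exact Matrix.mulVec_injective (funext h)
  · have h1 : Q.trace = Module.finrank ℝ K := by
      have hp : LinearMap.IsProj K (K.starProjection : _ →ₗ[ℝ] _) :=
        ⟨fun x => K.starProjection_apply_mem x,
          fun x hx => Submodule.starProjection_eq_self_iff.mpr hx⟩
      rw [← hp.trace, ← hQ, Matrix.coe_toEuclideanCLM_eq_toEuclideanLin,
        Matrix.toEuclideanLin_eq_toLin_orthonormal, Matrix.trace_toLin_eq]
    rw [h1]
    have h2 : Module.finrank ℝ K ≤ Module.finrank ℝ (EuclideanSpace ℝ (Fin m)) :=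
      LinearMap.finrank_range_le _
    rw [finrank_euclideanSpace_fin] at h2
    exact_mod_cast h2

lemma molae_weights {p m : ℕ} (hm : 0 < m) (hmp : m ≤ p) (a q : Fin p → ℝ)
    (ha0 : ∀ i, 0 ≤ a i) (hmono : ∀ i j, i ≤ j → a j ≤ a i)
    (hq0 : ∀ i, 0 ≤ q i) (hq1 : ∀ i, q i ≤ 1) (hq : ∑ i, q i ≤ m) :
    ∑ i : Fin p, (if (i : ℕ) < m then 0 else a i) ≤ ∑ i, (a i - a i * q i) := by
  let k : Fin p := ⟨m - 1, by omega⟩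
  have hc : ∑ i : Fin p, (if (i : ℕ) < m then (1 : ℝ) else 0) = m := by
    rw [Finset.sum_boole]
    congr 1
    rw [Fin.card_filter_val_lt]
    omega
  have h : ∑ i : Fin p, ((if (i : ℕ) < m then 0 else a i) +
      a k * ((if (i : ℕ) < m then (1 : ℝ) else 0) - q i)) ≤ ∑ i, (a i - a i * q i) := by
    apply Finset.sum_le_sum
    intro i _
    split_ifs with hi
    · have := hmono i k (by rw [Fin.le_def]; simp only [k]; omega)
      nlinarith [hq1 i]
    · have := hmono k i (by rw [Fin.le_def]; simp only [k]; omega)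
      nlinarith [hq0 i]
  rw [Finset.sum_add_distrib, ← Finset.mul_sum, Finset.sum_sub_distrib, hc] at h
  nlinarith [ha0 k]

lemma molae_eckart_young {p n m : ℕ} (hm : 0 < m) (hmp : m ≤ p)
    (S : Matrix (Fin p) (Fin n) ℝ) (a : Fin p → ℝ)
    (hSS : S * Sᵀ = Matrix.diagonal a)
    (ha0 : ∀ i, 0 ≤ a i) (hmono : ∀ i j, i ≤ j → a j ≤ a i)
    (C : Matrix (Fin p) (Fin m) ℝ) (D : Matrix (Fin m) (Fin n) ℝ) :
    ∑ i : Fin p, (if (i : ℕ) < m then 0 else a i) ≤ frobSq (S - C * D) := by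
  obtain ⟨Q, hQt, hQQ, hQC, hQtr⟩ := molae_exists_proj C
  have hd : ∀ i, Q i i = ∑ j, (Q i j) ^ 2 := by
    intro i
    have h1 := congrFun (congrFun hQQ i) i
    rw [Matrix.mul_apply] at h1
    rw [← h1]
    refine Finset.sum_congr rfl fun j _ => ?_
    have h2 := congrFun (congrFun hQt i) j
    rw [Matrix.transpose_apply] at h2
    rw [h2, pow_two]
  have hq0 : ∀ i, 0 ≤ Q i i := fun i => by
    rw [hd]; exact Finset.sum_nonneg fun _ _ => sq_nonneg _
  have hq1 : ∀ i, Q i i ≤ 1 := fun i => by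
    have h1 : (Q i i) ^ 2 ≤ Q i i := by
      conv_rhs => rw [hd]
      exact Finset.single_le_sum (f := fun j => (Q i j) ^ 2)
        (fun _ _ => sq_nonneg _) (Finset.mem_univ i)
    nlinarith
  have key : ∀ M : Matrix (Fin p) (Fin n) ℝ,
      frobSq M = frobSq (Q * M) + frobSq (M - Q * M) := by
    intro M
    simp only [molae_frobSq_trace, Matrix.transpose_sub, Matrix.transpose_mul, hQt,
      Matrix.mul_sub, Matrix.sub_mul, Matrix.trace_sub]
    have e1 : (Q * M * (Mᵀ * Q)).trace = (Q * (M * Mᵀ)).trace := by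
      rw [← Matrix.mul_assoc, Matrix.trace_mul_comm, Matrix.mul_assoc Q M, ← Matrix.mul_assoc,
        hQQ]
    have e2 : (M * (Mᵀ * Q)).trace = (Q * (M * Mᵀ)).trace := by
      rw [← Matrix.mul_assoc, Matrix.trace_mul_comm]
    have e3 : (Q * M * Mᵀ).trace = (Q * (M * Mᵀ)).trace := by rw [Matrix.mul_assoc]
    rw [e1, e2, e3]; ring
  have h1 := key (S - C * D)
  have h2 : S - C * D - Q * (S - C * D) = S - Q * S := by
    rw [Matrix.mul_sub, ← Matrix.mul_assoc, hQC]; abel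
  rw [h2] at h1
  have h3 := key S
  have h4 : frobSq S = ∑ i, a i := by
    rw [molae_frobSq_trace, hSS, Matrix.trace_diagonal]
  have h5 : frobSq (Q * S) = ∑ i, a i * Q i i := by
    rw [molae_frobSq_trace, Matrix.transpose_mul, hQt, ← Matrix.mul_assoc,
      Matrix.trace_mul_comm, Matrix.mul_assoc Q S, ← Matrix.mul_assoc, hQQ, hSS]
    simp [Matrix.trace, Matrix.mul_diagonal, mul_comm]
  have h6 := molae_weights hm hmp a (fun i => Q i i) ha0 hmono hq0 hq1 hQtr
  rw [Finset.sum_sub_distrib] at h6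
  have h7 := molae_frobSq_nonneg (Q * (S - C * D))
  linarith

/-- refined, activation-aware MoLAE transformation. Let
`W ∈ ℝ^{(mN)×n}`, `X ∈ ℝ^{n×s}` with `X Xᵀ` positive definite, and `L ∈ ℝ^{n×n}`
invertible with `X Xᵀ = L Lᵀ`. Let `W L = U S Vᵀ` be an SVD with singular values `σ`.
With `A* = U_m S_m^{1/2}` and `B* = S_m^{1/2} V_mᵀ L⁻¹`, the pair `(A*, B*)` is a global
minimizer of `(1/2)‖W X − A B X‖_F²`. -/
theorem refined_molae_transformation
    (m n N s : ℕ) (hm : 0 < m) (hn : 0 < n) (hN : 0 < N) (hs : 0 < s)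
    (hmp : m ≤ m * N) (hmn : m ≤ n)
    (W : Matrix (Fin (m * N)) (Fin n) ℝ) (X : Matrix (Fin n) (Fin s) ℝ)
    (hX : (X * Xᵀ).PosDef)
    (L : Matrix (Fin n) (Fin n) ℝ) (hL : IsUnit L.det) (hfact : X * Xᵀ = L * Lᵀ)
    (U : Matrix (Fin (m * N)) (Fin (m * N)) ℝ) (V : Matrix (Fin n) (Fin n) ℝ)
    (σ : ℕ → ℝ) (S : Matrix (Fin (m * N)) (Fin n) ℝ)
    (hU : Uᵀ * U = 1) (hV : Vᵀ * V = 1)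
    (hS : ∀ i j, S i j = if (i : ℕ) = (j : ℕ) then σ (i : ℕ) else 0)
    (hσ0 : ∀ i < min n (m * N), 0 ≤ σ i)
    (hσmono : ∀ i j, i ≤ j → j < min n (m * N) → σ j ≤ σ i)
    (hWL : W * L = U * S * Vᵀ)
    (Astar : Matrix (Fin (m * N)) (Fin m) ℝ) (Bstar : Matrix (Fin m) (Fin n) ℝ)
    (hA : Astar = (Matrix.of fun i (j : Fin m) => U i (Fin.castLE hmp j)) *
      Matrix.diagonal (fun j : Fin m => Real.sqrt (σ (j : ℕ))))
    (hB : Bstar = Matrix.diagonal (fun j : Fin m => Real.sqrt (σ (j : ℕ))) *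
      (Matrix.of fun i (j : Fin m) => V i (Fin.castLE hmn j))ᵀ * L⁻¹) :
    ∀ (A : Matrix (Fin (m * N)) (Fin m) ℝ) (B : Matrix (Fin m) (Fin n) ℝ),
      frobNorm (W * X - Astar * Bstar * X) ≤ frobNorm (W * X - A * B * X) := by
  intro A B
  have hVV : V * Vᵀ = 1 := mul_eq_one_comm.mp hV
  have hUU : U * Uᵀ = 1 := mul_eq_one_comm.mp hU
  -- replace `X` by `L`, then remove the orthogonal factors
  have red : ∀ M : Matrix (Fin (m * N)) (Fin n) ℝ,
      frobSq (W * X - M * X) = frobSq (S - Uᵀ * (M * L) * V) := by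
    intro M
    have e1 : frobSq (W * X - M * X) = frobSq (W * L - M * L) := by
      rw [← Matrix.sub_mul, ← Matrix.sub_mul, molae_frobSq_trace, molae_frobSq_trace,
        Matrix.transpose_mul, Matrix.transpose_mul, Matrix.mul_assoc, ← Matrix.mul_assoc X,
        hfact, Matrix.mul_assoc, Matrix.mul_assoc]
    have e2 : W * L - M * L = U * (S - Uᵀ * (M * L) * V) * Vᵀ := by
      have e3 : U * (Uᵀ * (M * L) * V) * Vᵀ = M * L := by
        calc U * (Uᵀ * (M * L) * V) * Vᵀ = (U * Uᵀ) * (M * L) * (V * Vᵀ) := by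
              simp only [Matrix.mul_assoc]
          _ = M * L := by rw [hUU, hVV, Matrix.one_mul, Matrix.mul_one]
      rw [Matrix.mul_sub, Matrix.sub_mul, e3, hWL]
    rw [e1, e2]
    generalize S - Uᵀ * (M * L) * V = Z
    rw [molae_frobSq_trace, molae_frobSq_trace]
    have e4 : U * Z * Vᵀ * (U * Z * Vᵀ)ᵀ = U * (Z * Zᵀ * Uᵀ) := by
      calc U * Z * Vᵀ * (U * Z * Vᵀ)ᵀ = U * Z * (Vᵀ * V) * Zᵀ * Uᵀ := by
            simp only [Matrix.transpose_mul, Matrix.transpose_transpose, Matrix.mul_assoc]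
        _ = _ := by rw [hV, Matrix.mul_one]; simp only [Matrix.mul_assoc]
    rw [e4, Matrix.trace_mul_comm, Matrix.mul_assoc, hU, Matrix.mul_one]
  let a : Fin (m * N) → ℝ := fun i => if (i : ℕ) < n then σ i ^ 2 else 0
  have hSS : S * Sᵀ = Matrix.diagonal a := by
    ext i j
    rw [Matrix.mul_apply, Matrix.diagonal_apply]
    simp only [Matrix.transpose_apply, hS, a]
    by_cases hi : (i : ℕ) < n
    · rw [Finset.sum_eq_single (⟨i, hi⟩ : Fin n)]
      · by_cases hij : i = j
        · subst hij; simp [hi, pow_two]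
        · have : (j : ℕ) ≠ i := fun h => hij (Fin.ext h.symm)
          simp [hij, this]
      · intro b _ hb
        have : (i : ℕ) ≠ b := fun h => hb (Fin.ext h.symm)
        simp [this]
      · simp
    · rw [Finset.sum_eq_zero]
      · simp [hi]
      · intro b _
        have : (i : ℕ) ≠ b := by have := b.2; omega
        simp [this]
  have ha0 : ∀ i, 0 ≤ a i := fun i => by
    simp only [a]; split_ifs <;> positivity
  have hmono : ∀ i j, i ≤ j → a j ≤ a i := by
    intro i j hij
    by_cases hj : (j : ℕ) < n
    · have hij' : (i : ℕ) ≤ j := hij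
      have hi : (i : ℕ) < n := by omega
      have hjm : (j : ℕ) < min n (m * N) := lt_min hj j.2
      simp only [a, hi, hj, if_true]
      exact pow_le_pow_left₀ (hσ0 _ hjm) (hσmono _ _ hij' hjm) 2
    · have : a j = 0 := by simp [a, hj]
      rw [this]; exact ha0 i
  -- the optimal value
  have hopt : S - Uᵀ * (Astar * Bstar * L) * V =
      Matrix.of fun (i : Fin (m * N)) j => if (i : ℕ) < m then 0 else S i j := by
    let J : Matrix (Fin (m * N)) (Fin m) ℝ := Matrix.of fun i j =>
      (1 : Matrix (Fin (m * N)) (Fin (m * N)) ℝ) i (Fin.castLE hmp j)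
    let J' : Matrix (Fin n) (Fin m) ℝ := Matrix.of fun i j =>
      (1 : Matrix (Fin n) (Fin n) ℝ) i (Fin.castLE hmn j)
    let R : Matrix (Fin m) (Fin m) ℝ :=
      Matrix.diagonal (fun j : Fin m => Real.sqrt (σ (j : ℕ)))
    have f1 : Uᵀ * (Matrix.of fun i (j : Fin m) => U i (Fin.castLE hmp j)) = J := by
      ext i j
      exact congrFun (congrFun hU i) (Fin.castLE hmp j)
    have f2 : (Matrix.of fun i (j : Fin m) => V i (Fin.castLE hmn j))ᵀ * V = J'ᵀ := by
      rw [← Matrix.transpose_transpose V, ← Matrix.transpose_mul]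
      congr 1
      ext i j
      exact congrFun (congrFun hV i) (Fin.castLE hmn j)
    have f3 : R * R = Matrix.diagonal (fun j : Fin m => σ (j : ℕ)) := by
      simp only [R, Matrix.diagonal_mul_diagonal]
      congr 1
      ext j
      exact Real.mul_self_sqrt (hσ0 _ (by have := j.2; exact lt_min (by omega) (by omega)))
    have f4 : Uᵀ * (Astar * Bstar * L) * V = J * (R * R) * J'ᵀ := by
      rw [← f1, ← f2, hA, hB]
      have f5 : L⁻¹ * (L * V) = V := by
        rw [← Matrix.mul_assoc, Matrix.nonsing_inv_mul _ hL, Matrix.one_mul]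
      simp only [Matrix.mul_assoc, f5, R]
    rw [f4, f3]
    ext i j
    rw [Matrix.sub_apply, Matrix.mul_apply]
    simp only [Matrix.mul_diagonal, Matrix.of_apply, Matrix.transpose_apply, J, J', hS,
      Matrix.one_apply]
    by_cases hi : (i : ℕ) < m
    · rw [Finset.sum_eq_single (⟨i, hi⟩ : Fin m)]
      · have c1 : i = Fin.castLE hmp ⟨i, hi⟩ := Fin.ext rfl
        have c2 : (j = Fin.castLE hmn ⟨i, hi⟩) ↔ (i : ℕ) = j := by
          rw [Fin.ext_iff]; exact eq_comm
        rw [if_pos c1, if_pos hi]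
        simp only [c2]
        split_ifs <;> simp
      · intro b _ hb
        have : i ≠ Fin.castLE hmp b := fun h => hb (Fin.ext (congrArg Fin.val h).symm)
        simp [this]
      · simp
    · rw [Finset.sum_eq_zero, sub_zero, if_neg hi]
      intro b _
      have : i ≠ Fin.castLE hmp b := fun h => hi (by rw [h]; exact b.2)
      simp [this]
  have hval : frobSq (S - Uᵀ * (Astar * Bstar * L) * V) =
      ∑ i : Fin (m * N), (if (i : ℕ) < m then 0 else a i) := by
    rw [hopt]
    unfold frobSq
    refine Finset.sum_congr rfl fun i _ => ?_
    have hd := congrFun (congrFun hSS i) i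
    rw [Matrix.mul_apply, Matrix.diagonal_apply_eq] at hd
    by_cases hi : (i : ℕ) < m
    · simp [hi]
    · simp only [Matrix.of_apply, hi, if_false, ← hd, Matrix.transpose_apply, pow_two]
  unfold frobNorm
  apply Real.sqrt_le_sqrt
  rw [red, red, hval]
  have hfac : Uᵀ * (A * B * L) * V = (Uᵀ * A) * (B * L * V) := by
    simp only [Matrix.mul_assoc]
  rw [hfac]
  exact molae_eckart_young hm hmp S a hSS ha0 hmono _ _
end

section
/- Let W ∈ ℝ^{(mN)×n}, X ∈ ℝ^{n×s} with X Xᵀ positive definite, and L ∈ ℝ^{n×n} invertible with X Xᵀ = L Lᵀ. Let σ̃_1 ≥ … ≥ σ̃_{min(n,mN)} be the singular values of W L. Then the optimal value of the activation-aware factorization problem satisfies min over A ∈ ℝ^{(mN)×m}, B ∈ ℝ^{m×n} of ‖W X − A B X‖_F² = ∑_{i=m+1}^{min(n,mN)} σ̃_i². -/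
open Matrix

theorem frobSq_eq_trace {p q : ℕ} (M : Matrix (Fin p) (Fin q) ℝ) :
    frobSq M = (M * Mᵀ).trace := by
  simp [frobSq, Matrix.trace, Matrix.mul_apply, pow_two]

theorem frobSq_nonneg {p q : ℕ} (M : Matrix (Fin p) (Fin q) ℝ) : 0 ≤ frobSq M := by
  unfold frobSq; positivity

theorem frobSq_mul_left {p q : ℕ} (U : Matrix (Fin p) (Fin p) ℝ) (M : Matrix (Fin p) (Fin q) ℝ)
    (hU : Uᵀ * U = 1) : frobSq (U * M) = frobSq M := by
  rw [frobSq_eq_trace, frobSq_eq_trace, Matrix.transpose_mul, Matrix.mul_assoc, Matrix.trace_mul_comm,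
    Matrix.mul_assoc, Matrix.mul_assoc, hU, Matrix.mul_one]

theorem frobSq_mul_right {p q r s : ℕ} (M : Matrix (Fin p) (Fin q) ℝ)
    (X : Matrix (Fin q) (Fin r) ℝ) (Y : Matrix (Fin q) (Fin s) ℝ)
    (h : X * Xᵀ = Y * Yᵀ) : frobSq (M * X) = frobSq (M * Y) := by
  rw [frobSq_eq_trace, frobSq_eq_trace, Matrix.transpose_mul, Matrix.transpose_mul, Matrix.mul_assoc,
    Matrix.mul_assoc, ← Matrix.mul_assoc X, ← Matrix.mul_assoc Y, h]

/-- Orthonormal factorization of a matrix. -/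
theorem exists_orth {p m : ℕ} (C : Matrix (Fin p) (Fin m) ℝ) :
    ∃ (r : ℕ) (_ : r ≤ m) (Q : Matrix (Fin p) (Fin r) ℝ) (E : Matrix (Fin r) (Fin m) ℝ),
      Qᵀ * Q = 1 ∧ C = Q * E := by
  let c : Fin m → EuclideanSpace ℝ (Fin p) := fun j => WithLp.toLp 2 (fun i => C i j)
  let K : Submodule ℝ (EuclideanSpace ℝ (Fin p)) := Submodule.span ℝ (Set.range c)
  let b := stdOrthonormalBasis ℝ K
  have hc : ∀ j, c j ∈ K := fun j => Submodule.subset_span ⟨j, rfl⟩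
  refine ⟨Module.finrank ℝ K, ?_, Matrix.of fun i l => (b l : EuclideanSpace ℝ (Fin p)) i,
    Matrix.of fun l j => inner ℝ (b l) (⟨c j, hc j⟩ : K), ?_, ?_⟩
  · exact (finrank_range_le_card (R := ℝ) c).trans_eq (Fintype.card_fin m)
  · ext k l
    have := orthonormal_iff_ite.mp b.orthonormal l k
    rw [Submodule.coe_inner, PiLp.inner_apply] at this
    simp only [Matrix.mul_apply, Matrix.transpose_apply, Matrix.of_apply, Matrix.one_apply]
    simp only [eq_comm (a := k)]
    simpa using this
  · ext i j
    have := b.sum_repr' (⟨c j, hc j⟩ : K)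
    have h2 := congrArg (fun x : K => (x : EuclideanSpace ℝ (Fin p)) i) this
    simp only [Submodule.coe_sum, Submodule.coe_smul, WithLp.ofLp_sum, Finset.sum_apply,
      WithLp.ofLp_smul, Pi.smul_apply, smul_eq_mul] at h2
    simp only [Matrix.mul_apply, Matrix.of_apply]
    rw [show C i j = c j i from rfl, ← h2]
    exact Finset.sum_congr rfl fun l _ => mul_comm _ _

theorem sum_diag (p n : ℕ) (f : ℕ → ℝ) :
    (∑ i : Fin p, ∑ j : Fin n, if (i : ℕ) = (j : ℕ) then f i else 0)
      = ∑ i ∈ Finset.range (min n p), f i := by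
  have h : ∀ i : ℕ, (∑ j : Fin n, if i = (j : ℕ) then f i else 0) = if i < n then f i else 0 := by
    intro i
    rw [Fin.sum_univ_eq_sum_range (fun j => if i = j then f i else 0) n]
    simp
  simp only [h]
  rw [Fin.sum_univ_eq_sum_range (fun i => if i < n then f i else 0) p, ← Finset.sum_filter]
  congr 1
  ext; simp; omega

theorem core_lower {p n m : ℕ} (hmp : m ≤ p) (σ : ℕ → ℝ) (S : Matrix (Fin p) (Fin n) ℝ)
    (hS : ∀ i j, S i j = if (i : ℕ) = (j : ℕ) then σ (i : ℕ) else 0)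
    (hσ0 : ∀ i < min n p, 0 ≤ σ i)
    (hσmono : ∀ i j, i ≤ j → j < min n p → σ j ≤ σ i)
    (C : Matrix (Fin p) (Fin m) ℝ) (D : Matrix (Fin m) (Fin n) ℝ) :
    ∑ i ∈ Finset.Ico m (min n p), σ i ^ 2 ≤ frobSq (S - C * D) := by
  obtain ⟨r, hr, Q, E, hQ, rfl⟩ := exists_orth C
  set τ : ℕ → ℝ := fun i => if i < min n p then σ i ^ 2 else 0 with hτ
  have hτanti : Antitone τ := by
    intro i j hij
    simp only [hτ]
    by_cases hj : j < min n p
    · rw [if_pos hj, if_pos (lt_of_le_of_lt hij hj)]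
      exact pow_le_pow_left₀ (hσ0 j hj) (hσmono i j hij hj) 2
    · rw [if_neg hj]; split_ifs <;> positivity
  set P : Matrix (Fin p) (Fin p) ℝ := 1 - Q * Qᵀ with hP
  have hPT : Pᵀ = P := by simp [hP]
  have hPQ : P * Q = 0 := by
    rw [hP, Matrix.sub_mul, Matrix.mul_assoc, hQ]; simp
  have hPP : P * P = P := by
    conv_lhs => rw [hP]
    rw [← hP, Matrix.sub_mul, Matrix.one_mul, sub_eq_self, Matrix.mul_assoc]
    have : Qᵀ * P = 0 := by
      rw [← hPT, ← Matrix.transpose_mul, hPQ]; simp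
    rw [this]; simp
  have hP0 : ∀ i, 0 ≤ P i i := by
    intro i
    rw [← hPP, Matrix.mul_apply]
    refine Finset.sum_nonneg fun j _ => ?_
    have : P j i = P i j := by conv_lhs => rw [← hPT, Matrix.transpose_apply]
    rw [this]; exact mul_self_nonneg _
  have hP1 : ∀ i, P i i ≤ 1 := by
    intro i
    rw [hP, Matrix.sub_apply, Matrix.one_apply_eq, Matrix.mul_apply, sub_le_self_iff]
    exact Finset.sum_nonneg fun j _ => mul_self_nonneg _
  have htr : P.trace = p - r := by
    rw [hP, Matrix.trace_sub, Matrix.trace_mul_comm, hQ]; simp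
  -- projection decreases the norm
  have hdec : ∀ M : Matrix (Fin p) (Fin n) ℝ, frobSq (P * M) ≤ frobSq M := by
    intro M
    have h1 : frobSq M - frobSq (P * M) = frobSq (Qᵀ * M) := by
      simp only [frobSq_eq_trace, Matrix.transpose_mul, hPT, Matrix.transpose_transpose]
      rw [Matrix.mul_assoc P, Matrix.trace_mul_comm P, Matrix.mul_assoc, Matrix.mul_assoc,
        Matrix.mul_assoc Qᵀ, Matrix.trace_mul_comm Qᵀ, Matrix.mul_assoc, Matrix.mul_assoc,
        ← Matrix.trace_sub, ← Matrix.mul_sub, hPP, hP]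
      simp [Matrix.mul_sub]
    linarith [frobSq_nonneg (Qᵀ * M)]
  have hSS : S * Sᵀ = Matrix.diagonal fun i : Fin p => τ i := by
    ext i k
    rw [Matrix.mul_apply, Matrix.diagonal_apply]
    simp only [Matrix.transpose_apply, hS]
    have e : ∀ j : Fin n, ((if (i : ℕ) = (j : ℕ) then σ i else 0) *
        (if (k : ℕ) = (j : ℕ) then σ k else 0) : ℝ)
        = if (i : ℕ) = (j : ℕ) then (if i = k then σ i ^ 2 else 0) else 0 := by
      intro j
      by_cases h1 : (i : ℕ) = j
      · by_cases h2 : i = k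
        · subst h2; simp [h1, pow_two]
        · have : ¬ (k : ℕ) = j := fun h => h2 (Fin.ext (h1.trans h.symm))
          simp [h2, this]
      · simp [h1]
    simp only [e]
    rw [Fin.sum_univ_eq_sum_range
      (fun j => if (i : ℕ) = j then (if i = k then σ i ^ 2 else 0) else 0) n]
    have hi := i.2
    by_cases h : i = k <;> simp [h, hτ]
  have hkey : frobSq (P * S) = ∑ i : Fin p, P i i * τ i := by
    rw [frobSq_eq_trace, Matrix.transpose_mul, hPT, Matrix.mul_assoc, Matrix.trace_mul_comm,
      Matrix.mul_assoc, Matrix.mul_assoc, hPP, ← Matrix.mul_assoc, hSS, Matrix.trace_mul_comm]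
    simp [Matrix.trace]
  have hPM : P * (S - Q * E * D) = P * S := by
    rw [Matrix.mul_sub, Matrix.mul_assoc Q, ← Matrix.mul_assoc P, hPQ]; simp
  have hfin := hdec (S - Q * E * D)
  rw [hPM, hkey] at hfin
  refine le_trans ?_ hfin
  have hind : ∀ g : ℕ → ℝ, (∑ i : Fin p, if m ≤ (i : ℕ) then g i else 0)
      = ∑ i ∈ Finset.Ico m p, g i := by
    intro g
    rw [Fin.sum_univ_eq_sum_range (fun i => if m ≤ i then g i else 0) p, ← Finset.sum_filter]
    congr 1
    ext; simp; omega
  have hlhs : ∑ i ∈ Finset.Ico m (min n p), σ i ^ 2 = ∑ i : Fin p, if m ≤ (i : ℕ) then τ i else 0 := by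
    rw [hind, hτ, ← Finset.sum_filter]
    congr 1
    ext; simp; omega
  have hone : (∑ i : Fin p, if m ≤ (i : ℕ) then (1 : ℝ) else 0) = p - m := by
    rw [hind (fun _ => 1)]; simp [Nat.cast_sub hmp]
  have hterm : ∀ i : Fin p, τ m * (P i i - if m ≤ (i : ℕ) then (1 : ℝ) else 0)
      ≤ P i i * τ i - if m ≤ (i : ℕ) then τ i else 0 := by
    intro i
    by_cases h : m ≤ (i : ℕ)
    · rw [if_pos h, if_pos h]
      nlinarith [hτanti h, hP1 i]
    · rw [if_neg h, if_neg h]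
      nlinarith [hτanti (le_of_not_ge h), hP0 i]
  have hsum := Finset.sum_le_sum fun i (_ : i ∈ Finset.univ) => hterm i
  rw [← Finset.mul_sum, Finset.sum_sub_distrib, Finset.sum_sub_distrib, hone, ← hlhs] at hsum
  have htr' : ∑ i, P i i = (p : ℝ) - r := htr
  rw [htr'] at hsum
  have hr' : (r : ℝ) ≤ m := by exact_mod_cast hr
  have hτm : 0 ≤ τ m := by simp only [hτ]; split_ifs <;> positivity
  nlinarith [mul_nonneg hτm (sub_nonneg.2 hr')]

theorem core_attain {p n m : ℕ} (σ : ℕ → ℝ) (S : Matrix (Fin p) (Fin n) ℝ)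
    (hS : ∀ i j, S i j = if (i : ℕ) = (j : ℕ) then σ (i : ℕ) else 0) :
    ∃ (C : Matrix (Fin p) (Fin m) ℝ) (D : Matrix (Fin m) (Fin n) ℝ),
      ∑ i ∈ Finset.Ico m (min n p), σ i ^ 2 = frobSq (S - C * D) := by
  refine ⟨Matrix.of fun i a => if (i : ℕ) = (a : ℕ) then 1 else 0,
    Matrix.of fun a j => if (a : ℕ) = (j : ℕ) then σ a else 0, ?_⟩
  have e : ∀ (i : Fin p) (j : Fin n), (S - (Matrix.of fun (i : Fin p) (a : Fin m) =>
      if (i : ℕ) = (a : ℕ) then (1 : ℝ) else 0) *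
      (Matrix.of fun (a : Fin m) (j : Fin n) => if (a : ℕ) = (j : ℕ) then σ a else 0)) i j ^ 2
      = if (i : ℕ) = (j : ℕ) then (if m ≤ (i : ℕ) then σ i ^ 2 else 0) else 0 := by
    intro i j
    rw [Matrix.sub_apply, hS, Matrix.mul_apply]
    simp only [Matrix.of_apply]
    rw [Fin.sum_univ_eq_sum_range
      (fun a => (if (i : ℕ) = a then (1 : ℝ) else 0) * (if a = (j : ℕ) then σ a else 0)) m]
    by_cases h1 : (i : ℕ) = j <;> by_cases h2 : (j : ℕ) < m <;> simp [h1, h2]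
  unfold frobSq
  simp only [e]
  rw [sum_diag p n (fun i => if m ≤ i then σ i ^ 2 else 0), ← Finset.sum_filter]
  congr 1
  ext; simp; omega

/-- Let `W ∈ ℝ^{(mN)×n}`, `X ∈ ℝ^{n×s}` with `X Xᵀ` positive definite,
and `L` invertible with `X Xᵀ = L Lᵀ`. If `σ̃_1 ≥ … ≥ σ̃_{min(n, mN)}` are the singular
values of `W L` (exhibited here by an SVD `W L = U S Vᵀ`), then the minimum over
`A ∈ ℝ^{(mN)×m}`, `B ∈ ℝ^{m×n}` of `‖W X − A B X‖_F²` equals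
`∑_{i = m+1}^{min(n, mN)} σ̃_i²` (with `σ` indexed from `0`, the sum over
`i ∈ [m, min(n, mN))`); `IsLeast` states this value is attained and is a lower bound. -/
theorem refined_molae_optimal_value
    (m n N s : ℕ) (hmp : m ≤ m * N) (hmn : m ≤ n)
    (W : Matrix (Fin (m * N)) (Fin n) ℝ) (X : Matrix (Fin n) (Fin s) ℝ)
    (hX : (X * Xᵀ).PosDef)
    (L : Matrix (Fin n) (Fin n) ℝ) (hL : IsUnit L.det) (hfact : X * Xᵀ = L * Lᵀ)
    (U : Matrix (Fin (m * N)) (Fin (m * N)) ℝ) (V : Matrix (Fin n) (Fin n) ℝ)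
    (σ : ℕ → ℝ) (S : Matrix (Fin (m * N)) (Fin n) ℝ)
    (hU : Uᵀ * U = 1) (hV : Vᵀ * V = 1)
    (hS : ∀ i j, S i j = if (i : ℕ) = (j : ℕ) then σ (i : ℕ) else 0)
    (hσ0 : ∀ i < min n (m * N), 0 ≤ σ i)
    (hσmono : ∀ i j, i ≤ j → j < min n (m * N) → σ j ≤ σ i)
    (hWL : W * L = U * S * Vᵀ) :
    IsLeast {r : ℝ | ∃ (A : Matrix (Fin (m * N)) (Fin m) ℝ) (B : Matrix (Fin m) (Fin n) ℝ),
        r = frobSq (W * X - A * B * X)}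
      (∑ i ∈ Finset.Ico m (min n (m * N)), σ i ^ 2) := by
  have hV' : V * Vᵀ = 1 := mul_eq_one_comm.mp hV
  have hUt : U * Uᵀ = 1 := mul_eq_one_comm.mp hU
  -- reduction to the diagonal problem
  have hred : ∀ (A : Matrix (Fin (m * N)) (Fin m) ℝ) (B : Matrix (Fin m) (Fin n) ℝ),
      frobSq (W * X - A * B * X) = frobSq (S - (Uᵀ * A) * (B * L * V)) := by
    intro A B
    rw [← Matrix.sub_mul, frobSq_mul_right _ X L hfact, Matrix.sub_mul, hWL]
    have h : U * S * Vᵀ - A * B * L = U * ((S - (Uᵀ * A) * (B * L * V)) * Vᵀ) := by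
      rw [Matrix.sub_mul, Matrix.mul_sub]
      congr 1
      · rw [Matrix.mul_assoc]
      · calc A * B * L = (U * Uᵀ) * A * B * L * (V * Vᵀ) := by rw [hUt, hV']; simp
          _ = _ := by simp only [Matrix.mul_assoc]
    rw [h, frobSq_mul_left _ _ hU,
      frobSq_mul_right _ Vᵀ (1 : Matrix (Fin n) (Fin n) ℝ) (by simp [hV]), Matrix.mul_one]
  constructor
  · obtain ⟨C, D, h⟩ := core_attain (m := m) σ S hS
    refine ⟨U * C, D * Vᵀ * L⁻¹, ?_⟩
    rw [hred, h]
    congr 2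
    have h1 : Uᵀ * (U * C) = C := by rw [← Matrix.mul_assoc, hU, Matrix.one_mul]
    have h2 : D * Vᵀ * L⁻¹ * L * V = D := by
      rw [Matrix.mul_assoc _ L⁻¹ L, Matrix.nonsing_inv_mul L hL, Matrix.mul_one, Matrix.mul_assoc,
        hV, Matrix.mul_one]
    rw [h1, h2]
  · rintro _ ⟨A, B, rfl⟩
    rw [hred]
    exact core_lower hmp σ S hS hσ0 hσmono _ _
end
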